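/- Let a ≤ n and m ≤ n be natural numbers, and consider GL_{n}(ℚ) containing commuting subgroups GL_{n−a}(ℚ) (acting on the last n−a coordinates) and the subgroup GL_{n−m}(ℚ) (acting on the last n−m coordinates). For n ≥ 2m + a, the natural map of double cosets GLₙ₋ₐ(ℚ) \ GLₙ(ℚ) / GL_{n−m}(ℚ) → GL_{n+1−a}(ℚ) \ GL_{n+1}(ℚ) / GL_{n+1−m}(ℚ) induced by the block inclusion GLₙ(ℚ) ⊂ GL_{n+1}(ℚ) is surjective. -/

import Mathlib

/-- The matrix `h` lies in the copy of GL_k inside GL_N acting on the span of the last k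
standard basis vectors and fixing the first N−k basis vectors. -/
def InLastBlock (N k : ℕ) (h : Matrix (Fin N) (Fin N) ℚ) : Prop :=
  ∀ i j : Fin N, ((i : ℕ) < N - k ∨ (j : ℕ) < N - k) →
    h i j = if i = j then 1 else 0

open Matrix in
/-- A rank-one perturbation of the identity, supported in the last block, is in `GL`. -/
theorem rankOne_aux (n c : ℕ) (p q : Fin (n + 1) → ℚ) (hp : ∀ i : Fin (n + 1), (i : ℕ) < c → p i = 0)
    (hq : ∀ i : Fin (n + 1), (i : ℕ) < c → q i = 0) (h : 1 + q ⬝ᵥ p ≠ 0) :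
    ∃ y : GL (Fin (n + 1)) ℚ, (y : Matrix (Fin (n + 1)) (Fin (n + 1)) ℚ) = 1 + vecMulVec p q ∧
      ∀ i j : Fin (n + 1), ((i : ℕ) < c ∨ (j : ℕ) < c) →
        (y : Matrix (Fin (n + 1)) (Fin (n + 1)) ℚ) i j = if i = j then 1 else 0 := by
  have hd : (1 + vecMulVec p q).det ≠ 0 := by
    rw [vecMulVec_eq Unit, det_one_add_replicateCol_mul_replicateRow]
    exact h
  refine ⟨GeneralLinearGroup.mkOfDetNeZero _ hd, rfl, ?_⟩
  intro i j hij
  change (1 + vecMulVec p q) i j = _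
  rw [Matrix.add_apply, Matrix.one_apply, vecMulVec_apply]
  rcases hij with hi | hj
  · rw [hp i hi]; simp
  · rw [hq j hj]; simp

open Matrix in
theorem block_mul_aux (n c : ℕ) (A B : Matrix (Fin (n + 1)) (Fin (n + 1)) ℚ)
    (hA : ∀ i j : Fin (n + 1), ((i : ℕ) < c ∨ (j : ℕ) < c) → A i j = if i = j then 1 else 0)
    (hB : ∀ i j : Fin (n + 1), ((i : ℕ) < c ∨ (j : ℕ) < c) → B i j = if i = j then 1 else 0) :
    ∀ i j : Fin (n + 1), ((i : ℕ) < c ∨ (j : ℕ) < c) → (A * B) i j = if i = j then 1 else 0 := by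
  intro i j hij
  rw [Matrix.mul_apply]
  rcases hij with hi | hj
  · rw [Finset.sum_congr rfl (fun k _ => by rw [hA i k (Or.inl hi)])]
    simp [hB i j (Or.inl hi)]
  · rw [Finset.sum_congr rfl (fun k _ => by rw [hB k j (Or.inr hj)])]
    simp [hA i j (Or.inr hj)]

open Matrix in
/-- Transitivity on pairs `(u, v)` with `u v = 1`. -/
theorem trans_aux (n c : ℕ) (hc : c ≤ n) (u v : Fin (n + 1) → ℚ)
    (hu : ∀ i : Fin (n + 1), (i : ℕ) < c → u i = 0)
    (hv : ∀ i : Fin (n + 1), (i : ℕ) < c → v i = 0) (huv : u ⬝ᵥ v = 1) :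
    ∃ y : GL (Fin (n + 1)) ℚ,
      (∀ i j : Fin (n + 1), ((i : ℕ) < c ∨ (j : ℕ) < c) →
        (y : Matrix (Fin (n + 1)) (Fin (n + 1)) ℚ) i j = if i = j then 1 else 0) ∧
      (y : Matrix (Fin (n + 1)) (Fin (n + 1)) ℚ) *ᵥ (Pi.single (Fin.last n) 1) = v ∧
      u ᵥ* (y : Matrix (Fin (n + 1)) (Fin (n + 1)) ℚ) = Pi.single (Fin.last n) 1 := by
  set e : Fin (n + 1) → ℚ := Pi.single (Fin.last n) 1 with he
  have hec : ∀ i : Fin (n + 1), (i : ℕ) < c → e i = 0 := by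
    intro i hi
    rw [he, Pi.single_eq_of_ne]
    rintro rfl
    simp at hi
    omega
  have hee : e ⬝ᵥ e = 1 := by simp [he]
  -- choose a functional nonzero on both `e` and `v`
  obtain ⟨t, ht1, ht2⟩ : ∃ t : ℚ, 1 + t * (u ⬝ᵥ e) ≠ 0 ∧ e ⬝ᵥ v + t ≠ 0 := by
    by_cases h0 : e ⬝ᵥ v = 0
    · by_cases h1 : 1 + u ⬝ᵥ e = 0
      · refine ⟨2, ?_, ?_⟩
        · intro h; linarith
        · rw [h0]; norm_num
      · exact ⟨1, by simpa using h1, by rw [h0]; norm_num⟩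
    · exact ⟨0, by simp, by simpa using h0⟩
  set s : ℚ := (1 + t * (u ⬝ᵥ e))⁻¹ with hs
  set q : Fin (n + 1) → ℚ := s • (e + t • u) with hq
  have hqe : q ⬝ᵥ e = 1 := by
    rw [hq, smul_dotProduct, add_dotProduct, smul_dotProduct, hee, smul_eq_mul, smul_eq_mul]
    exact inv_mul_cancel₀ ht1
  have hqv : q ⬝ᵥ v ≠ 0 := by
    rw [hq, smul_dotProduct, add_dotProduct, smul_dotProduct, huv, smul_eq_mul, smul_eq_mul, mul_one]
    exact mul_ne_zero (inv_ne_zero ht1) ht2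
  obtain ⟨y₁, hy₁, hb₁⟩ := rankOne_aux n c (v - e) q
    (fun i hi => by simp [hv i hi, hec i hi])
    (fun i hi => by simp [hq, hu i hi, hec i hi])
    (by rw [dotProduct_sub, hqe]; simpa using hqv)
  have hy₁e : (y₁ : Matrix (Fin (n + 1)) (Fin (n + 1)) ℚ) *ᵥ e = v := by
    rw [hy₁, add_mulVec, one_mulVec, vecMulVec_mulVec, hqe]
    simp
  set u' := u ᵥ* (y₁ : Matrix (Fin (n + 1)) (Fin (n + 1)) ℚ) with hu'
  have hu'e : u' ⬝ᵥ e = 1 := by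
    rw [hu', ← dotProduct_mulVec, hy₁e, huv]
  have hu'c : ∀ i : Fin (n + 1), (i : ℕ) < c → u' i = 0 := by
    intro i hi
    rw [hu', vecMul, dotProduct]
    rw [Finset.sum_congr rfl (fun k _ => by rw [hb₁ k i (Or.inr hi)])]
    simp [hu i hi]
  obtain ⟨y₂, hy₂, hb₂⟩ := rankOne_aux n c e (e - u') hec
    (fun i hi => by simp [hu'c i hi, hec i hi])
    (by rw [sub_dotProduct, hee, hu'e]; norm_num)
  refine ⟨y₁ * y₂, ?_, ?_, ?_⟩
  · exact block_mul_aux n c _ _ hb₁ hb₂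
  · rw [Units.val_mul, ← mulVec_mulVec, hy₂, add_mulVec, one_mulVec, vecMulVec_mulVec,
      sub_dotProduct, hee, hu'e]
    simp [hy₁e]
  · rw [Units.val_mul, ← vecMul_vecMul, ← hu', hy₂, vecMul_add, vecMul_one, vecMul_vecMulVec, hu'e]
    simp

open Matrix in
/-- The dimension count. -/
theorem dim_aux (a m n : ℕ) (ha : a ≤ n) (hm : m ≤ n) (hbound : 2 * m + a ≤ n)
    (g : GL (Fin (n + 1)) ℚ) :
    ∃ u v : Fin (n + 1) → ℚ, u ⬝ᵥ v = 1 ∧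
      (∀ i : Fin (n + 1), (i : ℕ) < m → u i = 0) ∧
      (∀ i : Fin (n + 1), (i : ℕ) < m → v i = 0) ∧
      (∀ i : Fin (n + 1), (i : ℕ) < a →
        (u ᵥ* ((g⁻¹ : GL (Fin (n + 1)) ℚ) : Matrix (Fin (n + 1)) (Fin (n + 1)) ℚ)) i = 0) ∧
      (∀ i : Fin (n + 1), (i : ℕ) < a →
        ((g : Matrix (Fin (n + 1)) (Fin (n + 1)) ℚ) *ᵥ v) i = 0) := by
  set G : Matrix (Fin (n + 1)) (Fin (n + 1)) ℚ := g.val with hG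
  set H : Matrix (Fin (n + 1)) (Fin (n + 1)) ℚ := (g⁻¹ : GL (Fin (n + 1)) ℚ).val with hH
  have hGH : G * H = 1 := by rw [hG, hH, ← Units.val_mul, mul_inv_cancel]; rfl
  have hHG : H * G = 1 := by rw [hG, hH, ← Units.val_mul, inv_mul_cancel]; rfl
  let T : (Fin (n + 1) → ℚ) →ₗ[ℚ] (Fin m → ℚ) × (Fin a → ℚ) :=
    (LinearMap.funLeft ℚ ℚ (fun i : Fin m => (⟨i, by omega⟩ : Fin (n + 1)))).prod
      ((LinearMap.funLeft ℚ ℚ (fun i : Fin a => (⟨i, by omega⟩ : Fin (n + 1)))).comp H.vecMulLinear)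
  let b : Fin m → (Fin (n + 1) → ℚ) := fun i => Pi.single ⟨i, by omega⟩ 1
  let A : Submodule ℚ (Fin (n + 1) → ℚ) := Submodule.span ℚ (Set.range b)
  let R : Submodule ℚ (Fin (n + 1) → ℚ) :=
    { carrier := {u | ∀ i : Fin (n + 1), a ≤ (i : ℕ) → (u ᵥ* H) i = 0}
      add_mem' := by
        intro x y hx hy i hi
        rw [add_vecMul, Pi.add_apply, hx i hi, hy i hi, add_zero]
      zero_mem' := by
        intro i hi
        simp
      smul_mem' := by
        intro r x hx i hi
        rw [smul_vecMul, Pi.smul_apply, hx i hi, smul_zero] }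
  have hker : ∀ u, u ∈ LinearMap.ker T → (∀ i : Fin (n + 1), (i : ℕ) < m → u i = 0) ∧
      (∀ i : Fin (n + 1), (i : ℕ) < a → (u ᵥ* H) i = 0) := by
    intro u hu
    have h : T u = 0 := hu
    refine ⟨fun i hi => ?_, fun i hi => ?_⟩
    · exact congrFun (congrArg Prod.fst h) ⟨i, hi⟩
    · exact congrFun (congrArg Prod.snd h) ⟨i, hi⟩
  have hinf : LinearMap.ker T ⊓ R = ⊥ := by
    rw [eq_bot_iff]
    rintro u ⟨h1, h2⟩
    have h3 : u ᵥ* H = 0 := by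
      funext i
      rcases lt_or_ge (i : ℕ) a with hi | hi
      · exact (hker u h1).2 i hi
      · exact h2 i hi
    have h4 : u = (u ᵥ* H) ᵥ* G := by rw [vecMul_vecMul, hHG, vecMul_one]
    rw [h3, zero_vecMul] at h4
    simp [h4]
  have hnot : ¬ LinearMap.ker T ≤ A ⊔ R := by
    intro hle
    have e1 := Submodule.finrank_sup_add_finrank_inf_eq (LinearMap.ker T) R
    rw [hinf, finrank_bot] at e1
    have e2 : Module.finrank ℚ ↥(LinearMap.ker T ⊔ R) ≤ Module.finrank ℚ ↥(A ⊔ R) :=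
      Submodule.finrank_mono (sup_le hle le_sup_right)
    have e3 := Submodule.finrank_sup_add_finrank_inf_eq A R
    have e4 : Module.finrank ℚ A ≤ m := by
      have := finrank_range_le_card (R := ℚ) b
      simpa [Set.finrank] using this
    have e5 := LinearMap.finrank_range_add_finrank_ker T
    have e6 : Module.finrank ℚ (LinearMap.range T) ≤ m + a := by
      have := Submodule.finrank_le (LinearMap.range T)
      simpa using this
    rw [Module.finrank_fin_fun] at e5
    omega
  obtain ⟨u, hu, huAR⟩ := SetLike.not_le_iff_exists.mp hnot
  obtain ⟨f, hfu, hf⟩ := Submodule.exists_le_ker_of_notMem huAR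
  have hfrep : ∀ z, f z = z ⬝ᵥ (fun i => f (Pi.single i 1)) := by
    intro z
    rw [LinearMap.pi_apply_eq_sum_univ f z]
    simp only [dotProduct, smul_eq_mul]
    refine Finset.sum_congr rfl fun i _ => ?_
    congr 2
    funext j
    simp [Pi.single_apply, eq_comm]
  set v₀ : Fin (n + 1) → ℚ := fun i => f (Pi.single i 1) with hv₀
  refine ⟨u, (f u)⁻¹ • v₀, ?_, (hker u hu).1, ?_, (hker u hu).2, ?_⟩
  · rw [dotProduct_smul, ← hfrep, smul_eq_mul, inv_mul_cancel₀ hfu]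
  · intro i hi
    have h : b ⟨i, hi⟩ ∈ A ⊔ R := le_sup_left (a := A) (Submodule.subset_span ⟨_, rfl⟩)
    have h2 : f (Pi.single i 1) = 0 := hf h
    simp [hv₀, h2]
  · intro i hi
    have h : G.row i ∈ R := by
      intro j hj
      have h1 : (G.row i ᵥ* H) j = (G * H) i j := rfl
      rw [h1, hGH, Matrix.one_apply_ne]
      rintro rfl
      omega
    have h2 : f (G.row i) = 0 := hf (le_sup_right (a := A) h)
    rw [hfrep] at h2
    rw [mulVec_smul, Pi.smul_apply]
    have h3 : (G *ᵥ v₀) i = 0 := h2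
    rw [h3, smul_zero]

/-- Surjectivity of the double coset map
GL_{n−a}(ℚ)\GL_n(ℚ)/GL_{n−m}(ℚ) → GL_{n+1−a}(ℚ)\GL_{n+1}(ℚ)/GL_{n+1−m}(ℚ)
induced by g ↦ diag(g,1), for n ≥ 2m + a: every g ∈ GL_{n+1}(ℚ) can be written, up to
left multiplication by GL_{n+1−a}(ℚ) and right multiplication by GL_{n+1−m}(ℚ), as a
block matrix diag(g', 1) with g' ∈ GLₙ(ℚ). -/
theorem stmt18 (a m n : ℕ) (ha : a ≤ n) (hm : m ≤ n) (hbound : 2 * m + a ≤ n)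
    (g : GL (Fin (n + 1)) ℚ) :
    ∃ x y : GL (Fin (n + 1)) ℚ,
      InLastBlock (n + 1) (n + 1 - a) (x : Matrix (Fin (n + 1)) (Fin (n + 1)) ℚ) ∧
      InLastBlock (n + 1) (n + 1 - m) (y : Matrix (Fin (n + 1)) (Fin (n + 1)) ℚ) ∧
      (∀ j : Fin (n + 1),
        ((x * g * y : GL (Fin (n + 1)) ℚ) : Matrix (Fin (n + 1)) (Fin (n + 1)) ℚ)
          (Fin.last n) j = if j = Fin.last n then 1 else 0) ∧
      (∀ i : Fin (n + 1),
        ((x * g * y : GL (Fin (n + 1)) ℚ) : Matrix (Fin (n + 1)) (Fin (n + 1)) ℚ)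
          i (Fin.last n) = if i = Fin.last n then 1 else 0) := by
  obtain ⟨u, v, huv, hum, hvm, hua, hva⟩ := dim_aux a m n ha hm hbound g
  obtain ⟨y, hyb, hye, huy⟩ := trans_aux n m hm u v hum hvm huv
  set w := Matrix.vecMul u ((g⁻¹ : GL (Fin (n + 1)) ℚ) : Matrix (Fin (n + 1)) (Fin (n + 1)) ℚ)
    with hw
  have hwg : Matrix.vecMul w (g : Matrix (Fin (n + 1)) (Fin (n + 1)) ℚ) = u := by
    rw [hw, Matrix.vecMul_vecMul, ← Units.val_mul, inv_mul_cancel, Units.val_one, Matrix.vecMul_one]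
  have hwv : dotProduct (Matrix.mulVec (g : Matrix (Fin (n + 1)) (Fin (n + 1)) ℚ) v) w = 1 := by
    rw [dotProduct_comm, Matrix.dotProduct_mulVec, hwg, huv]
  obtain ⟨z, hzb, hze, hgz⟩ := trans_aux n a ha _ w hva hua hwv
  have hdet : (Matrix.transpose (z : Matrix (Fin (n + 1)) (Fin (n + 1)) ℚ)).det ≠ 0 := by
    rw [Matrix.det_transpose]
    exact ((Matrix.isUnit_iff_isUnit_det _).mp z.isUnit).ne_zero
  set x := Matrix.GeneralLinearGroup.mkOfDetNeZero _ hdet with hx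
  have hxz : (x : Matrix (Fin (n + 1)) (Fin (n + 1)) ℚ)
      = Matrix.transpose (z : Matrix (Fin (n + 1)) (Fin (n + 1)) ℚ) := rfl
  refine ⟨x, y, ?_, ?_, ?_, ?_⟩
  · intro i j hij
    rw [hxz, Matrix.transpose_apply, hzb j i (by omega)]
    simp [eq_comm]
  · intro i j hij
    exact hyb i j (by omega)
  · intro j
    have h : Matrix.vecMul (Pi.single (Fin.last n) 1)
        ((x * g * y : GL (Fin (n + 1)) ℚ) : Matrix (Fin (n + 1)) (Fin (n + 1)) ℚ)
        = Pi.single (Fin.last n) 1 := by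
      rw [Units.val_mul, Units.val_mul, ← Matrix.vecMul_vecMul, ← Matrix.vecMul_vecMul, hxz,
        Matrix.vecMul_transpose, hze, hwg, huy]
    rw [Matrix.single_one_vecMul] at h
    have h2 := congrFun h j
    rw [Pi.single_apply] at h2
    exact h2
  · intro i
    have h : Matrix.mulVec
        ((x * g * y : GL (Fin (n + 1)) ℚ) : Matrix (Fin (n + 1)) (Fin (n + 1)) ℚ)
        (Pi.single (Fin.last n) 1) = Pi.single (Fin.last n) 1 := by
      rw [Units.val_mul, Units.val_mul, ← Matrix.mulVec_mulVec, ← Matrix.mulVec_mulVec, hye, hxz,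
        Matrix.mulVec_transpose, hgz]
    rw [Matrix.mulVec_single_one] at h
    have h2 := congrFun h i
    rw [Pi.single_apply] at h2
    exact h2
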